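/- arXiv:math/9803065 — 4 statements merged into one kernel-verified Lean document; each statement's English description precedes it below -/
import Mathlib

section
/- Suppose e is odd and set r := p^{(e+1)/2} (so r = √(pq)). Then e^{(n)} = e for every n ∈ {1,…,r} with p ∤ n, and e^{(n)} = 0 for every n ∈ {r, r+1, …, r+p}. -/
open Polynomial

noncomputable section

variable (p : ℕ) [Fact p.Prime]

/-- `fN n` is the least common multiple of the minimal polynomials over `F_p` of
`ω, ω², …, ω^{n-1}`. -/
def fN (F : Type) [Field F] [Algebra (ZMod p) F] (ω : Fˣ) (n : ℕ) : Polynomial (ZMod p) :=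
  Finset.lcm (Finset.Ico 1 n) (fun i => minpoly (ZMod p) (((ω : F)) ^ i))

/-- `eN n = deg f^{(n+1)} − deg f^{(n)}`. -/
def eN (F : Type) [Field F] [Algebra (ZMod p) F] (ω : Fˣ) (n : ℕ) : ℕ :=
  (fN p F ω (n + 1)).natDegree - (fN p F ω n).natDegree

theorem Nat.ModEq.eq_of_pos_of_le {a b N : ℕ} (h : a ≡ b [MOD N]) (ha : 0 < a) (hb : 0 < b)
    (haN : a ≤ N) (hbN : b ≤ N) : a = b := by
  rcases le_total a b with hab | hab
  · have h1 := (Nat.modEq_iff_dvd' hab).1 h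
    have := Nat.eq_zero_of_dvd_of_lt h1 (by omega)
    omega
  · have h1 := (Nat.modEq_iff_dvd' hab).1 h.symm
    have := Nat.eq_zero_of_dvd_of_lt h1 (by omega)
    omega

theorem Nat.pow_modEq_one_pow_sub_one {p : ℕ} (hp : 0 < p) (e : ℕ) :
    p ^ e ≡ 1 [MOD p ^ e - 1] :=
  ((Nat.modEq_iff_dvd' (Nat.one_le_pow _ _ hp)).2 dvd_rfl).symm

/-- An integer below `p ^ (m + 1)` not divisible by `p` is the smallest element of its `p`-cyclotomic
coset modulo `p ^ (2 * m + 1) - 1`, and this coset has full size. -/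
theorem Nat.eq_and_eq_zero_of_mul_pow_modEq {p m n i k : ℕ} (hp : 1 < p)
    (hn : n < p ^ (m + 1)) (hi : 0 < i) (hin : i ≤ n) (hpn : ¬ p ∣ n) (hk : k < 2 * m + 1)
    (h : n * p ^ k ≡ i [MOD p ^ (2 * m + 1) - 1]) : i = n ∧ k = 0 := by
  have hp0 : 0 < p := by omega
  have key : ∀ a l, 0 < a → a ≤ n → l ≤ m →
      0 < a * p ^ l ∧ a * p ^ l ≤ p ^ (2 * m + 1) - 1 := by
    intro a l ha han hl
    refine ⟨by positivity, Nat.le_sub_one_of_lt ?_⟩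
    calc a * p ^ l ≤ n * p ^ m := Nat.mul_le_mul han (Nat.pow_le_pow_right hp0 hl)
      _ < p ^ (m + 1) * p ^ m := Nat.mul_lt_mul_of_pos_right hn (by positivity)
      _ = p ^ (2 * m + 1) := by ring
  have hi' := key i 0 hi hin (Nat.zero_le m)
  have hn' := key n 0 (hi.trans_le hin) le_rfl (Nat.zero_le m)
  simp only [pow_zero, mul_one] at hi' hn'
  rcases le_or_gt k m with hkm | hkm
  · obtain ⟨h1, h2⟩ := key n k (hi.trans_le hin) le_rfl hkm
    have heq := h.eq_of_pos_of_le h1 hi h2 hi'.2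
    have hpk : 1 ≤ p ^ k := Nat.one_le_pow _ _ hp0
    have hni : i = n := le_antisymm hin (heq ▸ Nat.le_mul_of_pos_right n hpk)
    refine ⟨hni, ?_⟩
    by_contra hk0
    have : 1 < p ^ k := Nat.one_lt_pow hk0 hp
    nlinarith
  · exfalso
    obtain ⟨h1, h2⟩ := key i (2 * m + 1 - k) hi hin (by omega)
    have h3 : i * p ^ (2 * m + 1 - k) ≡ n [MOD p ^ (2 * m + 1) - 1] := by
      refine (h.symm.mul_right _).trans ?_
      rw [mul_assoc, ← pow_add, Nat.add_sub_cancel' hk.le]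
      simpa using (Nat.pow_modEq_one_pow_sub_one hp0 (2 * m + 1)).mul_left n
    refine hpn ?_
    rw [← h3.eq_of_pos_of_le h1 hn'.1 h2 hn'.2]
    exact Dvd.dvd.mul_left (dvd_pow_self p (by omega)) i

section FiniteField

variable {K L : Type*} [Field K] [Fintype K] [Field L] [Finite L] [Algebra K L]

theorem FiniteField.minpoly_pow_card_pow (x : L) (k : ℕ) :
    minpoly K (x ^ Fintype.card K ^ k) = minpoly K x := by
  have h := minpoly.algEquiv_eq (FiniteField.frobeniusAlgEquivOfAlgebraic K L ^ k) x
  rwa [AlgEquiv.coe_pow, FiniteField.coe_frobeniusAlgEquivOfAlgebraic_iterate] at h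

theorem FiniteField.exists_pow_card_pow_eq_of_minpoly_eq {x y : L}
    (h : minpoly K x = minpoly K y) :
    ∃ k < Module.finrank K L, x ^ Fintype.card K ^ k = y := by
  obtain ⟨σ, hσ⟩ := IsConjRoot.exists_algEquiv (K := K) (x := y) (y := x) h.symm
  obtain ⟨⟨k, hk⟩, rfl⟩ := (FiniteField.bijective_frobeniusAlgEquivOfAlgebraic_pow K L).2 σ
  refine ⟨k, hk, ?_⟩
  rwa [AlgEquiv.coe_pow, FiniteField.coe_frobeniusAlgEquivOfAlgebraic_iterate] at hσ

open IntermediateField in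
theorem FiniteField.pow_card_pow_natDegree_minpoly (x : L) :
    x ^ Fintype.card K ^ (minpoly K x).natDegree = x := by
  have := Fintype.ofFinite K⟮x⟯
  rw [← IntermediateField.adjoin.finrank (Algebra.IsIntegral.isIntegral x),
    ← Module.card_eq_pow_finrank (K := K)]
  simpa using congrArg (algebraMap K⟮x⟯ L) (FiniteField.pow_card (AdjoinSimple.gen K x))

end FiniteField

section

variable {p} {F : Type} [Field F] [Algebra (ZMod p) F] {ω : Fˣ}

theorem eN_eq_zero_of_minpoly_eq {i n : ℕ} (hi : 1 ≤ i) (hin : i < n)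
    (h : minpoly (ZMod p) ((ω : F) ^ n) = minpoly (ZMod p) ((ω : F) ^ i)) :
    eN p F ω n = 0 := by
  have hd : fN p F ω (n + 1) ∣ fN p F ω n := by
    refine Finset.lcm_dvd fun j hj => ?_
    rw [Finset.mem_Ico] at hj
    rcases (Nat.lt_succ_iff.1 hj.2).lt_or_eq with hjn | rfl
    · exact Finset.dvd_lcm (Finset.mem_Ico.2 ⟨hj.1, hjn⟩)
    · rw [h]
      exact Finset.dvd_lcm (f := fun i => minpoly (ZMod p) ((ω : F) ^ i))
        (Finset.mem_Ico.2 ⟨hi, hin⟩)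
  have hd' : fN p F ω n ∣ fN p F ω (n + 1) :=
    Finset.lcm_mono (Finset.Ico_subset_Ico_right n.le_succ)
  rw [eN, natDegree_eq_of_degree_eq
    (degree_eq_degree_of_associated (associated_of_dvd_dvd hd hd')), Nat.sub_self]

theorem eN_eq_natDegree_minpoly [Finite F] {n : ℕ} (hn : 1 ≤ n)
    (h : ∀ i, 1 ≤ i → i < n →
      minpoly (ZMod p) ((ω : F) ^ n) ≠ minpoly (ZMod p) ((ω : F) ^ i)) :
    eN p F ω n = (minpoly (ZMod p) ((ω : F) ^ n)).natDegree := by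
  have hint : ∀ x : F, IsIntegral (ZMod p) x := fun x => Algebra.IsIntegral.isIntegral x
  have hcop : IsCoprime (minpoly (ZMod p) ((ω : F) ^ n)) (∏ i ∈ (Finset.Ico 1 n).image
      (fun i => minpoly (ZMod p) ((ω : F) ^ i)), i) := by
    refine IsCoprime.prod_right fun f hf => ?_
    obtain ⟨i, hi, rfl⟩ := Finset.mem_image.1 hf
    rw [Finset.mem_Ico] at hi
    refine ((minpoly.irreducible (hint _)).coprime_iff_not_dvd).2 fun hd => ?_
    exact h i hi.1 hi.2 (eq_of_monic_of_associated (minpoly.monic (hint _))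
      (minpoly.monic (hint _)) ((minpoly.irreducible (hint _)).associated_of_dvd
        (minpoly.irreducible (hint _)) hd))
  have hcop' : IsCoprime (minpoly (ZMod p) ((ω : F) ^ n)) (fN p F ω n) := by
    refine hcop.of_isCoprime_of_dvd_right (Finset.lcm_dvd fun i hi => ?_)
    exact Finset.dvd_prod_of_mem (fun f => f)
      (Finset.mem_image_of_mem (fun i => minpoly (ZMod p) ((ω : F) ^ i)) hi)
  have hass : Associated (fN p F ω (n + 1)) (minpoly (ZMod p) ((ω : F) ^ n) * fN p F ω n) := by
    refine associated_of_dvd_dvd (Finset.lcm_dvd fun j hj => ?_) (hcop'.mul_dvd ?_ ?_)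
    · rw [Finset.mem_Ico] at hj
      rcases (Nat.lt_succ_iff.1 hj.2).lt_or_eq with hjn | rfl
      · exact Dvd.dvd.mul_left (Finset.dvd_lcm (Finset.mem_Ico.2 ⟨hj.1, hjn⟩)) _
      · exact dvd_mul_right _ _
    · exact Finset.dvd_lcm (f := fun i => minpoly (ZMod p) ((ω : F) ^ i))
        (Finset.mem_Ico.2 ⟨hn, n.lt_succ_self⟩)
    · exact Finset.lcm_mono (Finset.Ico_subset_Ico_right n.le_succ)
  have hne : fN p F ω n ≠ 0 := Finset.lcm_ne_zero_iff.2 fun i _ => minpoly.ne_zero (hint _)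
  rw [eN, natDegree_eq_of_degree_eq (degree_eq_degree_of_associated hass),
    natDegree_mul (minpoly.ne_zero (hint _)) hne, Nat.add_sub_cancel]

end

/-- Suppose `e` is odd, `r = p^{(e+1)/2} = √(pq)`.  Then `e^{(n)} = e` for every
`n ∈ {1,…,r}` with `p ∤ n`, and `e^{(n)} = 0` for every `n ∈ {r, …, r+p}`. -/
theorem stmt_8 (e : ℕ) (he : 1 ≤ e) (hodd : Odd e) (F : Type) [Field F] [Fintype F]
    [Algebra (ZMod p) F] (hF : Fintype.card F = p ^ e)
    (ω : Fˣ) (hω : ∀ x : Fˣ, x ∈ Subgroup.zpowers ω) :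
    (∀ n, 1 ≤ n → n ≤ p ^ ((e + 1) / 2) → ¬ p ∣ n → eN p F ω n = e) ∧
    (∀ n, p ^ ((e + 1) / 2) ≤ n → n ≤ p ^ ((e + 1) / 2) + p → eN p F ω n = 0) := by
  obtain ⟨m, rfl⟩ := hodd
  have hp : 1 < p := (Fact.out : p.Prime).one_lt
  have hp0 : 0 < p := by omega
  rw [show (2 * m + 1 + 1) / 2 = m + 1 by omega]
  have hord : orderOf ω = p ^ (2 * m + 1) - 1 := by
    rw [orderOf_eq_card_of_forall_mem_zpowers hω, Nat.card_units, Nat.card_eq_fintype_card, hF]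
  have hpow : ∀ a b : ℕ, (ω : F) ^ a = (ω : F) ^ b ↔ a ≡ b [MOD p ^ (2 * m + 1) - 1] := by
    intro a b
    rw [← hord, ← pow_eq_pow_iff_modEq, Units.ext_iff, Units.val_pow_eq_pow_val,
      Units.val_pow_eq_pow_val]
  have hfin : Module.finrank (ZMod p) F = 2 * m + 1 := by
    have h := Module.card_eq_pow_finrank (K := ZMod p) (V := F)
    rw [hF, ZMod.card] at h
    exact (Nat.pow_right_injective hp h).symm
  have hconj : ∀ n i k : ℕ, n * p ^ k ≡ i [MOD p ^ (2 * m + 1) - 1] →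
      minpoly (ZMod p) ((ω : F) ^ n) = minpoly (ZMod p) ((ω : F) ^ i) := by
    intro n i k h
    rw [← (hpow _ _).2 h, pow_mul]
    simpa [ZMod.card] using
      (FiniteField.minpoly_pow_card_pow (K := ZMod p) ((ω : F) ^ n) k).symm
  constructor
  · intro n hn hnr hpn
    have hnlt : n < p ^ (m + 1) :=
      lt_of_le_of_ne hnr fun h => hpn (h ▸ dvd_pow_self p (by omega))
    rw [eN_eq_natDegree_minpoly hn]
    · by_contra hne
      have hle := minpoly.natDegree_le (A := ZMod p) ((ω : F) ^ n)
      have hpos := minpoly.natDegree_pos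
        (Algebra.IsIntegral.isIntegral (R := ZMod p) ((ω : F) ^ n))
      have h := FiniteField.pow_card_pow_natDegree_minpoly (K := ZMod p) ((ω : F) ^ n)
      rw [ZMod.card, ← pow_mul, hpow] at h
      have := (Nat.eq_and_eq_zero_of_mul_pow_modEq hp hnlt hn le_rfl hpn (by omega) h).2
      omega
    · intro i hi hin heq
      obtain ⟨k, hk, h⟩ := FiniteField.exists_pow_card_pow_eq_of_minpoly_eq heq
      rw [ZMod.card, ← pow_mul, hpow] at h
      have := (Nat.eq_and_eq_zero_of_mul_pow_modEq hp hnlt hi hin.le hpn (by omega) h).1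
      omega
  · intro n hrn hnr
    have hr : 0 < p ^ (m + 1) := by positivity
    by_cases hpn : p ∣ n
    · obtain ⟨c, rfl⟩ := hpn
      have hc : 0 < c := Nat.pos_of_mul_pos_left (hr.trans_le hrn)
      refine eN_eq_zero_of_minpoly_eq hc (by nlinarith) (hconj c (p * c) 1 ?_).symm
      rw [pow_one, mul_comm c]
    · obtain ⟨j, rfl⟩ := Nat.exists_eq_add_of_le hrn
      have hpr : p ∣ p ^ (m + 1) := dvd_pow_self p (by omega)
      have hj0 : j ≠ 0 := by
        rintro rfl
        exact hpn hpr
      have hjp : j < p := lt_of_le_of_ne (by omega) fun h => hpn (dvd_add hpr (dvd_of_eq h.symm))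
      have hpm : 1 ≤ p ^ m := Nat.one_le_pow _ _ hp0
      refine eN_eq_zero_of_minpoly_eq (i := 1 + j * p ^ m) (by omega) ?_ (hconj _ _ m ?_)
      · have : (j + 1) * p ^ m ≤ p * p ^ m := Nat.mul_le_mul_right _ hjp
        rw [pow_succ']
        linarith [Nat.pos_of_ne_zero hj0]
      · rw [add_mul, ← pow_add, show m + 1 + m = 2 * m + 1 by ring]
        exact (Nat.pow_modEq_one_pow_sub_one hp0 _).add_right _

end
end

section
/- For every integer n ≥ 1, Σ_{j∈ℕ*} r(n,j) = n − 1 (the sum is finite, since r(n,j) = 0 for j ≥ n). -/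
/-- The exponents below the least `k` with `n ≤ j * p ^ k` are those with `j * p ^ l < n`. -/
lemma lt_iff_mul_pow_lt_of_isLeast {p n j k : ℕ} (hp : 0 < p)
    (hk : IsLeast {l : ℕ | n ≤ j * p ^ l} k) (l : ℕ) : l < k ↔ j * p ^ l < n := by
  constructor
  · intro h
    by_contra! hc
    exact absurd (hk.2 hc) (by omega)
  · intro h
    by_contra! hc
    have h₁ : n ≤ j * p ^ k := hk.1
    have h₂ : j * p ^ k ≤ j * p ^ l := Nat.mul_le_mul_left _ (Nat.pow_le_pow_right hp hc)
    omega

lemma factorization_mul_pow_of_not_dvd {p j : ℕ} (hp : p.Prime) (h : ¬ p ∣ j) (l : ℕ) :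
    (j * p ^ l).factorization p = l := by
  have hj : j ≠ 0 := by
    rintro rfl
    exact h (dvd_zero p)
  rw [Nat.factorization_mul hj (pow_ne_zero _ hp.ne_zero)]
  simp [hp.factorization_pow, Nat.factorization_eq_zero_of_not_dvd h]

/-- Let `p` be a prime and for `n, j ≥ 1` let `r(n,j)` be the least `l ≥ 0` with
`j·p^l ≥ n`.  Then for every `n ≥ 1`, `Σ_{j∈ℕ*} r(n,j) = n − 1`, where `ℕ*` is the
set of positive integers prime to `p` (the sum is finite since `r(n,j) = 0` for
`j ≥ n`). -/
theorem stmt_15 (p : ℕ) (hp : p.Prime) (r : ℕ → ℕ → ℕ)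
    (hr : ∀ n j : ℕ, 1 ≤ j → IsLeast {l : ℕ | n ≤ j * p ^ l} (r n j))
    (n : ℕ) (hn : 1 ≤ n) :
    (∀ j : ℕ, 1 ≤ j → n ≤ j → r n j = 0) ∧
    ∑ᶠ j ∈ {j : ℕ | 0 < j ∧ ¬ p ∣ j}, r n j = n - 1 := by
  have hlt (j : ℕ) (hj : 1 ≤ j) (l : ℕ) : l < r n j ↔ j * p ^ l < n :=
    lt_iff_mul_pow_lt_of_isLeast hp.pos (hr n j hj) l
  have hzero (j : ℕ) (hj : 1 ≤ j) (hnj : n ≤ j) : r n j = 0 := by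
    have := hlt j hj 0
    simp only [pow_zero, mul_one] at this
    omega
  refine ⟨hzero, ?_⟩
  have hsum : ∑ᶠ j ∈ {j : ℕ | 0 < j ∧ ¬ p ∣ j}, r n j =
      ∑ j ∈ (Finset.Ico 1 n).filter (fun j => ¬ p ∣ j), r n j := by
    refine finsum_mem_eq_sum_of_inter_support_eq _ ?_
    ext j
    simp only [Set.mem_inter_iff, Set.mem_ofPred_eq, Function.mem_support, Finset.coe_filter,
      Finset.mem_Ico]
    constructor
    · rintro ⟨⟨hj, hpj⟩, h0⟩
      exact ⟨⟨⟨hj, by by_contra! hc; exact h0 (hzero j hj hc)⟩, hpj⟩, h0⟩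
    · rintro ⟨⟨⟨hj, -⟩, hpj⟩, h0⟩
      exact ⟨⟨hj, hpj⟩, h0⟩
  have hcard : (((Finset.Ico 1 n).filter (fun j => ¬ p ∣ j)).sigma
      (fun j => Finset.range (r n j))).card = (Finset.Ico 1 n).card := by
    refine Finset.card_nbij' (fun x => x.1 * p ^ x.2)
      (fun m => ⟨m / p ^ m.factorization p, m.factorization p⟩) ?_ ?_ ?_ ?_
    · rintro ⟨j, l⟩ h
      simp only [Finset.coe_sigma, Set.mem_sigma_iff, Finset.mem_coe, Finset.mem_filter,
        Finset.mem_Ico, Finset.mem_range] at h ⊢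
      obtain ⟨⟨⟨hj, -⟩, -⟩, hl⟩ := h
      exact ⟨Nat.mul_pos hj (pow_pos hp.pos l), (hlt j hj l).1 hl⟩
    · intro m hm
      simp only [Finset.coe_sigma, Set.mem_sigma_iff, Finset.mem_coe, Finset.mem_filter,
        Finset.mem_Ico, Finset.mem_range] at hm ⊢
      have hm0 : m ≠ 0 := by omega
      have hpos : 1 ≤ m / p ^ m.factorization p := Nat.ordCompl_pos p hm0
      refine ⟨⟨⟨hpos, (Nat.div_le_self _ _).trans_lt hm.2⟩, Nat.not_dvd_ordCompl hp hm0⟩, ?_⟩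
      rw [hlt _ hpos, Nat.div_mul_cancel (Nat.ordProj_dvd m p)]
      exact hm.2
    · rintro ⟨j, l⟩ h
      simp only [Finset.coe_sigma, Set.mem_sigma_iff, Finset.mem_coe, Finset.mem_filter] at h
      simp only [factorization_mul_pow_of_not_dvd hp h.1.2,
        Nat.mul_div_cancel _ (pow_pos hp.pos l)]
    · intro m _
      exact Nat.div_mul_cancel (Nat.ordProj_dvd m p)
  rw [hsum]
  simpa using hcard
end

section
/- Let m_1, …, m_r ∈ M be ℤ_p-linearly independent. Then there exist positive integers n_1 ≤ n_2 ≤ … ≤ n_r such that for every integer n ≥ 1, the subgroup ℤ·m_1^{(n)} + … + ℤ·m_r^{(n)} of M^{(n)} has order exactly p^{Σ_{i=1}^{r} r(n, n_i)}. -/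
noncomputable section

/-- `ℕ*`: positive integers prime to `p`. -/
abbrev NStar (p : ℕ) : Type := {j : ℕ // 0 < j ∧ ¬ p ∣ j}

/-- The projection `M → M^{(n)}`, reducing the `(j,β)`-component of
`m : ℕ* × B → ℤ_p` modulo `p^{r(n,j)}`. -/
def Mproj (p : ℕ) [Fact p.Prime] (ι : Type) (r : ℕ → ℕ → ℕ) (n : ℕ)
    (m : NStar p × ι → ℤ_[p]) :
    (x : NStar p × ι) → ZMod (p ^ r n (x.1 : ℕ)) :=
  fun x => PadicInt.toZModPow (r n (x.1 : ℕ)) (m x)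

section Span

variable {R V κ : Type*} [CommRing R] [AddCommGroup V] [Module R V] [DecidableEq κ]

theorem Submodule.span_range_update_of_isUnit [Fintype κ] (e : κ → V) (b : κ → R) (i : κ)
    (hb : IsUnit (b i)) :
    Submodule.span R (Set.range (Function.update e i (∑ k, b k • e k))) =
      Submodule.span R (Set.range e) := by
  set e' := Function.update e i (∑ k, b k • e k) with he'
  have hne : ∀ k, k ≠ i → e k ∈ Submodule.span R (Set.range e') := fun k hk =>
    Submodule.subset_span ⟨k, by simp [he', hk]⟩
  apply le_antisymm
  · rw [Submodule.span_le]
    rintro _ ⟨k, rfl⟩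
    by_cases hk : k = i
    · subst hk
      simp only [he', Function.update_self, SetLike.mem_coe]
      exact Submodule.sum_mem _ fun j _ => Submodule.smul_mem _ _ (Submodule.subset_span ⟨j, rfl⟩)
    · exact Submodule.subset_span ⟨k, by simp [he', hk]⟩
  · rw [Submodule.span_le]
    rintro _ ⟨k, rfl⟩
    by_cases hk : k = i
    · subst hk
      obtain ⟨u, hu⟩ := hb
      have hy : ∑ j, b j • e j ∈ Submodule.span R (Set.range e') :=
        Submodule.subset_span ⟨k, by simp [he']⟩
      have hek : e k = u⁻¹.1 • (∑ j, b j • e j - ∑ j ∈ Finset.univ.erase k, b j • e j) := by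
        rw [← Finset.add_sum_erase _ _ (Finset.mem_univ k), add_sub_cancel_right, ← hu, smul_smul]
        simp
      rw [SetLike.mem_coe, hek]
      refine Submodule.smul_mem _ _ (Submodule.sub_mem _ hy (Submodule.sum_mem _ fun j hj => ?_))
      exact Submodule.smul_mem _ _ (hne j (Finset.ne_of_mem_erase hj))
    · exact hne k hk

theorem LinearIndependent.update_sum_of_isUnit [Fintype κ] {e : κ → V}
    (he : LinearIndependent R e) (b : κ → R) (i : κ) (hb : IsUnit (b i)) :
    LinearIndependent R (Function.update e i (∑ k, b k • e k)) := by
  refine he.update i _ ⟨1, one_mem _, Finsupp.equivFunOnFinite.symm b, ?_, ?_⟩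
  · simpa using hb.mem_nonZeroDivisors
  · simp [Finsupp.linearCombination_apply, Finsupp.sum_fintype]

end Span

section WeightedNorm

variable {p : ℕ} [hp : Fact p.Prime] {X : Type*}

theorem PadicInt.pow_dvd_iff_le_valuation {x : ℤ_[p]} (hx : x ≠ 0) (n : ℕ) :
    (p : ℤ_[p]) ^ n ∣ x ↔ n ≤ x.valuation := by
  rw [← Ideal.mem_span_singleton, PadicInt.mem_span_pow_iff_le_valuation x hx]

/-- The minimum of `w x * p ^ (v x).valuation` over the support of `v` (and `0` if `v = 0`). -/
def weightedNorm (w : X → ℕ) (v : X → ℤ_[p]) : ℕ :=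
  sInf {k | ∃ x, v x ≠ 0 ∧ w x * p ^ (v x).valuation = k}

theorem exists_weightedNorm_eq (w : X → ℕ) {v : X → ℤ_[p]} (hv : v ≠ 0) :
    ∃ x, v x ≠ 0 ∧ w x * p ^ (v x).valuation = weightedNorm w v := by
  obtain ⟨x, hx⟩ := Function.ne_iff.mp hv
  exact Nat.sInf_mem (s := {k | ∃ x, v x ≠ 0 ∧ w x * p ^ (v x).valuation = k}) ⟨_, x, hx, rfl⟩

theorem weightedNorm_le (w : X → ℕ) (v : X → ℤ_[p]) {x : X} (hx : v x ≠ 0) :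
    weightedNorm w v ≤ w x * p ^ (v x).valuation :=
  Nat.sInf_le ⟨x, hx, rfl⟩

theorem le_weightedNorm_iff (w : X → ℕ) {v : X → ℤ_[p]} (hv : v ≠ 0) (n : ℕ) :
    n ≤ weightedNorm w v ↔ ∀ x, v x ≠ 0 → n ≤ w x * p ^ (v x).valuation := by
  refine ⟨fun h x hx => h.trans (weightedNorm_le w v hx), fun h => ?_⟩
  obtain ⟨x, hx, h'⟩ := exists_weightedNorm_eq w hv
  exact h' ▸ h x hx

theorem weightedNorm_pos {w : X → ℕ} (hw : ∀ x, 0 < w x) {v : X → ℤ_[p]} (hv : v ≠ 0) :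
    0 < weightedNorm w v :=
  (le_weightedNorm_iff w hv 1).2 fun x _ => Nat.mul_pos (hw x) (pow_pos hp.1.pos _)

theorem weightedNorm_smul (w : X → ℕ) {a : ℤ_[p]} (ha : a ≠ 0) {v : X → ℤ_[p]} (hv : v ≠ 0) :
    weightedNorm w (a • v) = p ^ a.valuation * weightedNorm w v := by
  have key : ∀ x, v x ≠ 0 → w x * p ^ ((a • v) x).valuation =
      p ^ a.valuation * (w x * p ^ (v x).valuation) := by
    intro x hx
    rw [Pi.smul_apply, smul_eq_mul, PadicInt.valuation_mul ha hx, pow_add]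
    ring
  apply le_antisymm
  · obtain ⟨x, hx, h⟩ := exists_weightedNorm_eq w hv
    rw [← h, ← key x hx]
    exact weightedNorm_le w _ (by simp [ha, hx])
  · rw [le_weightedNorm_iff w (smul_ne_zero ha hv)]
    intro x hx
    have hx' : v x ≠ 0 := fun h => hx (by simp [h])
    rw [key x hx']
    exact Nat.mul_le_mul_left _ (weightedNorm_le w v hx')

/-- The vectors whose `x`-component is divisible by `p ^ ρ x` for all `x`. -/
def divLevel (ρ : X → ℕ) : Submodule ℤ_[p] (X → ℤ_[p]) where
  carrier := {v | ∀ x, (p : ℤ_[p]) ^ ρ x ∣ v x}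
  add_mem' h h' x := dvd_add (h x) (h' x)
  zero_mem' _ := dvd_zero _
  smul_mem' _ _ h x := Dvd.dvd.mul_left (h x) _

theorem mem_divLevel {ρ : X → ℕ} {v : X → ℤ_[p]} :
    v ∈ divLevel ρ ↔ ∀ x, (p : ℤ_[p]) ^ ρ x ∣ v x := Iff.rfl

theorem mem_divLevel_iff_le_weightedNorm {w ρ : X → ℕ} {n : ℕ}
    (h : ∀ x l, ρ x ≤ l ↔ n ≤ w x * p ^ l) {v : X → ℤ_[p]} (hv : v ≠ 0) :
    v ∈ divLevel ρ ↔ n ≤ weightedNorm w v := by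
  rw [le_weightedNorm_iff w hv, mem_divLevel]
  refine forall_congr' fun x => ?_
  by_cases hx : v x = 0
  · simp [hx]
  · rw [PadicInt.pow_dvd_iff_le_valuation hx, h]
    simp [hx]

variable {κ : Type*} [Fintype κ]

theorem smul_mem_divLevel_of_sum_mem [DecidableEq κ] {w : X → ℕ} {e : κ → X → ℤ_[p]}
    (he : LinearIndependent ℤ_[p] e)
    (hmax : ∀ i y, LinearIndependent ℤ_[p] (Function.update e i y) →
      Submodule.span ℤ_[p] (Set.range (Function.update e i y)) =
        Submodule.span ℤ_[p] (Set.range e) → weightedNorm w y ≤ weightedNorm w (e i))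
    {ρ : X → ℕ} {n : ℕ} (h : ∀ x l, ρ x ≤ l ↔ n ≤ w x * p ^ l) {a : κ → ℤ_[p]}
    (ha : ∑ i, a i • e i ∈ divLevel ρ) (i : κ) : a i • e i ∈ divLevel ρ := by
  classical
  by_contra hi
  let I : Finset κ := {i | a i • e i ∉ divLevel ρ}
  have hI : ∑ i ∈ I, a i • e i ∈ divLevel ρ := by
    have hIc : ∑ i ∈ Finset.univ.filter (fun i => ¬ a i • e i ∉ divLevel ρ), a i • e i ∈
        divLevel ρ := Submodule.sum_mem _ fun k hk => by simpa using hk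
    rw [← Finset.sum_filter_add_sum_filter_not Finset.univ (fun i => a i • e i ∉ divLevel ρ)] at ha
    exact (Submodule.add_mem_iff_left _ hIc).1 ha
  have ha0 : ∀ k ∈ I, a k ≠ 0 := by
    intro k hk h0
    simp [I, h0] at hk
  obtain ⟨k, hk, hkmin⟩ := I.exists_min_image (fun k => (a k).valuation) ⟨i, by simpa [I] using hi⟩
  have hdvd : ∀ j, ∃ b, j ∈ I → a j = (p : ℤ_[p]) ^ (a k).valuation * b := by
    intro j
    by_cases hj : j ∈ I
    · obtain ⟨b, hb⟩ := (PadicInt.pow_dvd_iff_le_valuation (ha0 j hj) _).2 (hkmin j hj)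
      exact ⟨b, fun _ => hb⟩
    · exact ⟨0, fun h => absurd h hj⟩
  choose b hb using hdvd
  let b' : κ → ℤ_[p] := fun j => if j ∈ I then b j else 0
  have hpne : (p : ℤ_[p]) ^ (a k).valuation ≠ 0 := pow_ne_zero _ (NeZero.ne _)
  have hunit : IsUnit (b' k) := by
    have h1 := PadicInt.unitCoeff_spec (ha0 k hk)
    have h2 := hb k hk
    have : b k = PadicInt.unitCoeff (ha0 k hk) := by
      apply mul_left_cancel₀ hpne
      rw [← h2, mul_comm, ← h1]
    simp [b', hk, this]
  have hzsum : (p : ℤ_[p]) ^ (a k).valuation • ∑ j, b' j • e j = ∑ j ∈ I, a j • e j := by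
    simp only [b', ite_smul, zero_smul, Finset.sum_ite_mem, Finset.univ_inter, Finset.smul_sum,
      smul_smul]
    exact Finset.sum_congr rfl fun j hj => by rw [← hb j hj]
  have hLI := he.update_sum_of_isUnit b' k hunit
  have hle := hmax k _ hLI (Submodule.span_range_update_of_isUnit e b' k hunit)
  have hz : ∑ j, b' j • e j ≠ 0 := by simpa using hLI.ne_zero k
  rw [← hzsum, mem_divLevel_iff_le_weightedNorm h (smul_ne_zero hpne hz),
    weightedNorm_smul w hpne hz] at hI
  have hk' : a k • e k ∉ divLevel ρ := by simpa [I] using hk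
  rw [mem_divLevel_iff_le_weightedNorm h (smul_ne_zero (ha0 k hk) (he.ne_zero k)),
    weightedNorm_smul w (ha0 k hk) (he.ne_zero k)] at hk'
  apply hk'
  refine hI.trans ?_
  simpa [PadicInt.valuation_pow, PadicInt.valuation_p] using Nat.mul_le_mul_left _ hle

/-- `p`-adic combinations of a linearly independent family that are highly divisible have
coefficients divisible by `p`. -/
theorem exists_forall_dvd_of_le_weightedNorm (w : X → ℕ)
    {m : κ → X → ℤ_[p]} (hm : LinearIndependent ℤ_[p] m) :
    ∃ K, ∀ a : κ → ℤ_[p], K ≤ weightedNorm w (∑ i, a i • m i) → ∀ i, (p : ℤ_[p]) ∣ a i := by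
  by_contra! hcon
  let t : ℕ → Set (κ → ℤ_[p]) := fun n =>
    {a | (∃ i, ¬ (p : ℤ_[p]) ∣ a i) ∧ ∀ x l, w x * p ^ l < n →
      (p : ℤ_[p]) ^ (l + 1) ∣ (∑ i, a i • m i) x}
  have hclosed : ∀ n, IsClosed (t n) := by
    intro n
    have hc : ∀ x, Continuous fun a : κ → ℤ_[p] => ‖(∑ i, a i • m i) x‖ := by
      intro x
      simp only [Finset.sum_apply, Pi.smul_apply, smul_eq_mul]
      fun_prop
    have : t n = (⋃ i, {a | 1 ≤ ‖a i‖}) ∩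
        ⋂ x, ⋂ l, ⋂ (_ : w x * p ^ l < n),
          {a | ‖(∑ i, a i • m i) x‖ ≤ (p : ℝ) ^ (-((l + 1 : ℕ) : ℤ))} := by
      ext a
      simp only [t, ← PadicInt.norm_lt_one_iff_dvd, not_lt, PadicInt.norm_le_pow_iff_mem_span_pow,
        Ideal.mem_span_singleton, Set.mem_inter_iff, Set.mem_iUnion, Set.mem_iInter,
        Set.mem_ofPred_eq]
    rw [this]
    refine IsClosed.inter (isClosed_iUnion_of_finite fun i =>
      isClosed_le continuous_const (continuous_apply i).norm) ?_
    exact isClosed_iInter fun x => isClosed_iInter fun l => isClosed_iInter fun _ =>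
      isClosed_le (hc x) continuous_const
  obtain ⟨a, ha⟩ := IsCompact.nonempty_iInter_of_sequence_nonempty_isCompact_isClosed t
    (fun n a ha => ⟨ha.1, fun x l h => ha.2 x l (h.trans n.lt_succ_self)⟩)
    (fun n => by
      obtain ⟨a, ha, i, hi⟩ := hcon n
      refine ⟨a, ⟨i, hi⟩, fun x l hl => ?_⟩
      by_cases hx : (∑ i, a i • m i) x = 0
      · rw [hx]; exact dvd_zero _
      · rw [PadicInt.pow_dvd_iff_le_valuation hx]
        have h1 := hl.trans_le (ha.trans (weightedNorm_le w _ hx))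
        exact (Nat.pow_lt_pow_iff_right hp.1.one_lt).1 (lt_of_mul_lt_mul_left' h1))
    (hclosed 0).isCompact hclosed
  rw [Set.mem_iInter] at ha
  have hzero : ∑ i, a i • m i = 0 := by
    ext1 x
    by_contra hx
    have := (ha (w x * p ^ ((∑ i, a i • m i) x).valuation + 1)).2 x _ (Nat.lt_succ_self _)
    rw [PadicInt.pow_dvd_iff_le_valuation hx] at this
    omega
  obtain ⟨i, hi⟩ := (ha 0).1
  exact hi (by rw [Fintype.linearIndependent_iff.1 hm a hzero i]; exact dvd_zero _)

theorem exists_orthogonal_basis (w : X → ℕ)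
    {m : κ → X → ℤ_[p]} (hm : LinearIndependent ℤ_[p] m) :
    ∃ e : κ → X → ℤ_[p], LinearIndependent ℤ_[p] e ∧
      Submodule.span ℤ_[p] (Set.range e) = Submodule.span ℤ_[p] (Set.range m) ∧
      ∀ (ρ : X → ℕ) (n : ℕ), (∀ x l, ρ x ≤ l ↔ n ≤ w x * p ^ l) → ∀ a : κ → ℤ_[p],
        ∑ i, a i • e i ∈ divLevel ρ → ∀ i, a i • e i ∈ divLevel ρ := by
  classical
  obtain ⟨K, hK⟩ := exists_forall_dvd_of_le_weightedNorm w hm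
  let S : Set (κ → X → ℤ_[p]) := {e | LinearIndependent ℤ_[p] e ∧
    Submodule.span ℤ_[p] (Set.range e) = Submodule.span ℤ_[p] (Set.range m)}
  have hbound : ∀ e ∈ S, ∀ i, weightedNorm w (e i) ≤ K := by
    rintro e ⟨he, hspan⟩ i
    by_contra! hlt
    have hei : e i ∈ Submodule.span ℤ_[p] (Set.range m) :=
      hspan ▸ Submodule.subset_span ⟨i, rfl⟩
    obtain ⟨a, ha⟩ := (Submodule.mem_span_range_iff_exists_fun _).1 hei
    choose b hb using hK a (ha ▸ hlt.le)
    have hy : ∑ j, b j • m j ∈ Submodule.span ℤ_[p] (Set.range e) :=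
      hspan ▸ Submodule.sum_mem _ fun j _ =>
        Submodule.smul_mem _ _ (Submodule.subset_span ⟨j, rfl⟩)
    obtain ⟨c, hc⟩ := (Submodule.mem_span_range_iff_exists_fun _).1 hy
    have hrel : ∑ j, ((p : ℤ_[p]) * c j - if j = i then 1 else 0) • e j = 0 := by
      simp only [sub_smul, mul_smul, Finset.sum_sub_distrib, ← Finset.smul_sum, ite_smul, one_smul,
        zero_smul, Finset.sum_ite_eq', Finset.mem_univ, if_true, hc, ← ha]
      simp [Finset.smul_sum, hb, mul_smul]
    have h1 := Fintype.linearIndependent_iff.1 he _ hrel i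
    rw [if_pos rfl, sub_eq_zero] at h1
    exact PadicInt.prime_p.not_isUnit (IsUnit.of_mul_eq_one _ h1)
  let T : Set ℕ := (fun e => ∑ i, weightedNorm w (e i)) '' S
  have hT : BddAbove T := by
    refine ⟨∑ _i : κ, K, ?_⟩
    rintro _ ⟨e, he, rfl⟩
    exact Finset.sum_le_sum fun i _ => hbound e he i
  obtain ⟨e, he, hsup⟩ := Nat.sSup_mem (s := T) ⟨_, m, ⟨hm, rfl⟩, rfl⟩ hT
  refine ⟨e, he.1, he.2, fun ρ n h a ha => smul_mem_divLevel_of_sum_mem he.1 ?_ h ha⟩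
  intro i y hLI hspan
  have hle : ∑ k, weightedNorm w (Function.update e i y k) ≤ ∑ k, weightedNorm w (e k) := by
    have := le_csSup hT ⟨Function.update e i y, ⟨hLI, hspan.trans he.2⟩, rfl⟩
    rwa [← hsup] at this
  rw [← Finset.add_sum_erase _ _ (Finset.mem_univ i),
    ← Finset.add_sum_erase _ (fun k => weightedNorm w (e k)) (Finset.mem_univ i),
    Finset.sum_congr rfl (g := fun k => weightedNorm w (e k))
      fun k hk => by rw [Function.update_of_ne (Finset.ne_of_mem_erase hk)]] at hle
  simpa using hle

end WeightedNorm

section Count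

variable {p : ℕ} [hp : Fact p.Prime] {X : Type*}

theorem PadicInt.toZModPow_eq_zero_iff (k : ℕ) (a : ℤ_[p]) :
    PadicInt.toZModPow k a = 0 ↔ (p : ℤ_[p]) ^ k ∣ a := by
  rw [← RingHom.mem_ker, PadicInt.ker_toZModPow, Ideal.mem_span_singleton]

/-- Componentwise reduction modulo `p ^ ρ x`. -/
def reduceHom (ρ : X → ℕ) : (X → ℤ_[p]) →+ ((x : X) → ZMod (p ^ ρ x)) where
  toFun v x := PadicInt.toZModPow (ρ x) (v x)
  map_zero' := by ext1 x; simp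
  map_add' v v' := by ext1 x; simp

theorem reduceHom_apply (ρ : X → ℕ) (v : X → ℤ_[p]) (x : X) :
    reduceHom ρ v x = PadicInt.toZModPow (ρ x) (v x) := rfl

theorem reduceHom_eq_zero_iff (ρ : X → ℕ) (v : X → ℤ_[p]) :
    reduceHom ρ v = 0 ↔ v ∈ divLevel ρ := by
  simp only [funext_iff, reduceHom_apply, Pi.zero_apply, PadicInt.toZModPow_eq_zero_iff,
    mem_divLevel]

theorem reduceHom_surjective (ρ : X → ℕ) :
    Function.Surjective (reduceHom (p := p) ρ) := by
  intro f
  choose g hg using fun x => ZMod.ringHom_surjective (PadicInt.toZModPow (p := p) (ρ x)) (f x)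
  exact ⟨g, funext hg⟩

variable {κ : Type*} [Fintype κ]

/-- If `ρ` is bounded, integers suffice to generate the reduction of a `p`-adic span. -/
theorem closure_reduceHom_eq_map_span {ρ : X → ℕ} {R : ℕ} (hR : ∀ x, ρ x ≤ R)
    (m : κ → X → ℤ_[p]) :
    AddSubgroup.closure (Set.range fun i => reduceHom ρ (m i)) =
      (Submodule.span ℤ_[p] (Set.range m)).toAddSubgroup.map (reduceHom ρ) := by
  apply le_antisymm
  · rw [AddSubgroup.closure_le]
    rintro _ ⟨i, rfl⟩
    exact ⟨m i, Submodule.subset_span ⟨i, rfl⟩, rfl⟩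
  · rintro _ ⟨v, hv, rfl⟩
    obtain ⟨a, rfl⟩ := (Submodule.mem_span_range_iff_exists_fun _).1 hv
    rw [map_sum]
    refine AddSubgroup.sum_mem _ fun i _ => ?_
    have h : reduceHom ρ (a i • m i) = (a i).appr R • reduceHom ρ (m i) := by
      rw [← map_nsmul, ← sub_eq_zero, ← map_sub, reduceHom_eq_zero_iff]
      intro x
      have := Ideal.mem_span_singleton.1 (PadicInt.appr_spec R (a i))
      rw [Pi.sub_apply, Pi.smul_apply, Pi.smul_apply, smul_eq_mul, nsmul_eq_mul, ← sub_mul]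
      exact ((pow_dvd_pow _ (hR x)).trans this).mul_right _
    rw [h]
    exact AddSubgroup.nsmul_mem _ (AddSubgroup.subset_closure (Set.mem_range_self i)) _

theorem card_map_span_reduceHom {ρ : X → ℕ} {e : κ → X → ℤ_[p]} {σ : κ → ℕ}
    (h : ∀ a : κ → ℤ_[p], ∑ i, a i • e i ∈ divLevel ρ ↔ a ∈ divLevel σ) :
    Nat.card ((Submodule.span ℤ_[p] (Set.range e)).toAddSubgroup.map (reduceHom ρ)) =
      p ^ ∑ i, σ i := by
  let f : (κ → ℤ_[p]) →+ ((x : X) → ZMod (p ^ ρ x)) :=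
    (reduceHom ρ).comp (Fintype.linearCombination ℤ_[p] e).toAddMonoidHom
  have hf : ∀ a, f a = reduceHom ρ (∑ i, a i • e i) := fun a => rfl
  have hrange : (Submodule.span ℤ_[p] (Set.range e)).toAddSubgroup.map (reduceHom ρ) =
      f.range := by
    ext y
    simp only [AddSubgroup.mem_map, Submodule.mem_toAddSubgroup,
      Submodule.mem_span_range_iff_exists_fun, AddMonoidHom.mem_range, hf]
    constructor
    · rintro ⟨_, ⟨a, rfl⟩, rfl⟩
      exact ⟨a, rfl⟩
    · rintro ⟨a, rfl⟩
      exact ⟨_, ⟨a, rfl⟩, rfl⟩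
  have hker : f.ker = (reduceHom (p := p) σ).ker := by
    ext a
    rw [AddMonoidHom.mem_ker, AddMonoidHom.mem_ker, hf, reduceHom_eq_zero_iff,
      reduceHom_eq_zero_iff, h]
  rw [hrange, ← Nat.card_congr (QuotientAddGroup.quotientKerEquivRange f).toEquiv, hker,
    Nat.card_congr (QuotientAddGroup.quotientKerEquivOfSurjective _
      (reduceHom_surjective σ)).toEquiv, Nat.card_pi, ← Finset.prod_pow_eq_pow_sum]
  simp

end Count

/-- Let `m_1, …, m_s ∈ M` be `ℤ_p`-linearly independent.  Then there are positive
integers `n_1 ≤ … ≤ n_s` such that for every `n ≥ 1` the subgroup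
`ℤ·m_1^{(n)} + … + ℤ·m_s^{(n)}` of `M^{(n)}` has order `p^{Σ_i r(n, n_i)}`. -/
theorem stmt_18 (p : ℕ) [Fact p.Prime] (e : ℕ) (he : 1 ≤ e)
    (ι : Type) [Fintype ι] (hι : Fintype.card ι = e)
    (r : ℕ → ℕ → ℕ)
    (hr : ∀ n j : ℕ, 1 ≤ j → IsLeast {l : ℕ | n ≤ j * p ^ l} (r n j))
    (s : ℕ) (m : Fin s → (NStar p × ι → ℤ_[p]))
    (hm : LinearIndependent ℤ_[p] m) :
    ∃ ns : Fin s → ℕ, (∀ i, 0 < ns i) ∧ Monotone ns ∧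
      ∀ n : ℕ, 1 ≤ n →
        Nat.card (AddSubgroup.closure (Set.range fun i => Mproj p ι r n (m i))) =
          p ^ (∑ i : Fin s, r n (ns i)) := by
  classical
  have hr' : ∀ n j : ℕ, 1 ≤ j → ∀ l, r n j ≤ l ↔ n ≤ j * p ^ l := by
    intro n j hj l
    refine ⟨fun h => (hr n j hj).1.trans (Nat.mul_le_mul_left _ ?_), fun h => (hr n j hj).2 h⟩
    exact Nat.pow_le_pow_right (Fact.out : p.Prime).pos h
  let w : NStar p × ι → ℕ := fun x => x.1
  have hw : ∀ x, 0 < w x := fun x => x.1.2.1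
  obtain ⟨b, hb, hspan, horth⟩ := exists_orthogonal_basis w hm
  let N : Fin s → ℕ := fun i => weightedNorm w (b i)
  have hN : ∀ i, 0 < N i := fun i => weightedNorm_pos hw (hb.ne_zero i)
  refine ⟨N ∘ Tuple.sort N, fun i => hN _, Tuple.monotone_sort N, fun n _ => ?_⟩
  let ρ : NStar p × ι → ℕ := fun x => r n x.1
  have hρ : ∀ x l, ρ x ≤ l ↔ n ≤ w x * p ^ l := fun x l => hr' n _ x.1.2.1 l
  have hR : ∀ x, ρ x ≤ r n 1 := by
    intro x
    rw [hρ]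
    have h := (hr' n 1 le_rfl (r n 1)).1 le_rfl
    exact h.trans (Nat.mul_le_mul_right _ (hw x))
  have hsum : ∑ i, r n ((N ∘ Tuple.sort N) i) = ∑ i, r n (N i) :=
    Equiv.sum_comp (Tuple.sort N) fun i => r n (N i)
  rw [hsum]
  change Nat.card (AddSubgroup.closure (Set.range fun i => reduceHom ρ (m i))) = _
  rw [closure_reduceHom_eq_map_span hR, ← hspan]
  refine card_map_span_reduceHom fun a => ?_
  have hterm : ∀ i, a i • b i ∈ divLevel ρ ↔ (p : ℤ_[p]) ^ r n (N i) ∣ a i := by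
    intro i
    by_cases h0 : a i = 0
    · simp [h0]
    · rw [mem_divLevel_iff_le_weightedNorm hρ (smul_ne_zero h0 (hb.ne_zero i)),
        weightedNorm_smul w h0 (hb.ne_zero i), PadicInt.pow_dvd_iff_le_valuation h0,
        hr' n _ (hN i), mul_comm]
  simp only [mem_divLevel (v := a), ← hterm]
  exact ⟨fun h => horth ρ n hρ a h, fun h => Submodule.sum_mem _ fun i _ => h i⟩

end
end

section
/- Let m_1, …, m_r ∈ M be ℤ_p-linearly independent. Then there exist positive integers n_1 ≤ … ≤ n_r with the following property: writing n* := n/p^{v_p(n)} for the prime-to-p part of a positive integer n (v_p the p-adic valuation), δ^{(n)} := #{ i ∈ {1,…,r} : n_i ≤ n and n_i* = n* }, and λ^{(n)} := log_p of the index of ℤ·m_1^{(n)} + … + ℤ·m_r^{(n)} in M^{(n)} (this index is a power of p), one has λ^{(n+1)} = λ^{(n)} + e − δ^{(n)} for every integer n ≥ 1. -/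
noncomputable section

/-- `n* = n / p^{v_p(n)}`, the prime-to-`p` part of `n`. -/
def nstar (p n : ℕ) : ℕ := n / p ^ padicValNat p n

section Counting

open Finset

theorem nstar_mul_pow {p : ℕ} [Fact p.Prime] {a : ℕ} (ha : ¬ p ∣ a) (l : ℕ) :
    nstar p (a * p ^ l) = a := by
  have hp : p.Prime := Fact.out
  have ha0 : a ≠ 0 := fun h => ha (h ▸ dvd_zero p)
  rw [nstar, padicValNat.mul ha0 (pow_ne_zero _ hp.ne_zero), padicValNat.prime_pow,
    padicValNat.eq_zero_of_not_dvd ha, zero_add, Nat.mul_div_cancel _ (pow_pos hp.pos _)]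

theorem exists_eq_mul_pow {p : ℕ} [Fact p.Prime] {n : ℕ} (hn : n ≠ 0) :
    ∃ a l, ¬ p ∣ a ∧ n = a * p ^ l := by
  obtain ⟨l, a, ha, h⟩ :=
    Nat.exists_eq_pow_mul_and_not_dvd hn p (Fact.out : p.Prime).ne_one
  exact ⟨a, l, ha, h.trans (mul_comm _ _)⟩

theorem nstar_mul_self {p : ℕ} [Fact p.Prime] {n : ℕ} (hn : n ≠ 0) :
    nstar p (p * n) = nstar p n := by
  obtain ⟨a, l, ha, rfl⟩ := exists_eq_mul_pow (p := p) hn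
  rw [nstar_mul_pow ha, show p * (a * p ^ l) = a * p ^ (l + 1) by ring, nstar_mul_pow ha]

/-- The increment of `δ` at `k` along the multiplicative progression `k / p ↦ k`. -/
def jump (p : ℕ) (δ : ℕ → ℕ) (k : ℕ) : ℕ := if p ∣ k then δ k - δ (k / p) else δ k

theorem sum_jump_range {p : ℕ} (hp : 0 < p) {δ : ℕ → ℕ} (hδ : ∀ n, δ n ≤ δ (p * n)) (n : ℕ) :
    ∑ k ∈ range (p * n), jump p δ k + ∑ k ∈ range n, δ k = ∑ k ∈ range (p * n), δ k := by
  induction n with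
  | zero => simp
  | succ n ih =>
    have hblock : ∑ i ∈ range p, jump p δ (p * n + i) + δ n = ∑ i ∈ range p, δ (p * n + i) := by
      obtain ⟨q, rfl⟩ : ∃ q, p = q + 1 := ⟨p - 1, by omega⟩
      rw [sum_range_succ', sum_range_succ']
      have h0 : jump (q + 1) δ ((q + 1) * n + 0) + δ n = δ ((q + 1) * n + 0) := by
        have := hδ n
        simp only [jump, add_zero, dvd_mul_right, if_true, Nat.mul_div_cancel_left n hp]
        omega
      have h1 : ∀ i ∈ range q,
          jump (q + 1) δ ((q + 1) * n + (i + 1)) = δ ((q + 1) * n + (i + 1)) := by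
        intro i hi
        rw [jump, if_neg]
        intro hdvd
        have := Nat.le_of_dvd (by omega) ((Nat.dvd_add_right (dvd_mul_right _ _)).1 hdvd)
        have := mem_range.1 hi
        omega
      rw [sum_congr rfl h1]
      omega
    rw [sum_range_succ δ n, mul_add, mul_one, sum_range_add, sum_range_add δ]
    omega

theorem sum_jump_filter {p : ℕ} [Fact p.Prime] {δ : ℕ → ℕ} (hδ : ∀ n, δ n ≤ δ (p * n)) {n : ℕ}
    (hn : n ≠ 0) :
    ∑ k ∈ range (n + 1) with nstar p k = nstar p n, jump p δ k = δ n := by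
  have hp : p.Prime := Fact.out
  induction n using Nat.strong_induction_on with
  | _ n ih =>
    have hfix : ∀ {k a l : ℕ}, ¬ p ∣ a → n = a * p ^ l → nstar p k = nstar p n →
        k ≤ n → ∃ b ≤ l, k = a * p ^ b := by
      intro k a l ha hl hk hkn
      have hk0 : k ≠ 0 := by
        rintro rfl
        rw [hl, nstar_mul_pow ha] at hk
        simp only [nstar, Nat.zero_div] at hk
        exact ha (hk ▸ dvd_zero p)
      obtain ⟨c, b, hc, rfl⟩ := exists_eq_mul_pow (p := p) hk0
      rw [hl, nstar_mul_pow ha, nstar_mul_pow hc] at hk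
      subst hk
      refine ⟨b, ?_, rfl⟩
      have hc0 : c ≠ 0 := by
        rintro rfl
        exact hc (dvd_zero p)
      rw [hl, Nat.mul_le_mul_left_iff (Nat.pos_of_ne_zero hc0),
        Nat.pow_le_pow_iff_right hp.one_lt] at hkn
      exact hkn
    rw [sum_filter, sum_range_succ, if_pos rfl, ← sum_filter]
    obtain ⟨a, l, ha, hl⟩ := exists_eq_mul_pow (p := p) hn
    rcases l with _ | l
    · have : ∀ k ∈ (range n).filter (fun k => nstar p k = nstar p n), jump p δ k = 0 := by
        intro k hk
        rw [mem_filter, mem_range] at hk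
        obtain ⟨b, hb, rfl⟩ := hfix ha hl hk.2 hk.1.le
        rw [Nat.le_zero.1 hb, ← hl] at hk
        omega
      rw [sum_eq_zero this, zero_add, jump, if_neg]
      rwa [hl, pow_zero, mul_one]
    · have hn' : n = p * (a * p ^ l) := by rw [hl]; ring
      have hn0 : a * p ^ l ≠ 0 := fun h => hn (by rw [hn', h, mul_zero])
      have hlt : a * p ^ l < n := by
        rw [hn']
        exact lt_mul_of_one_lt_left (Nat.pos_of_ne_zero hn0) hp.one_lt
      have hstar : nstar p (a * p ^ l) = nstar p n := by rw [hn', nstar_mul_self hn0]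
      have hset : (range n).filter (fun k => nstar p k = nstar p n) =
          (range (a * p ^ l + 1)).filter (fun k => nstar p k = nstar p (a * p ^ l)) := by
        ext k
        simp only [mem_filter, mem_range, hstar]
        refine and_congr_left fun hk => ⟨fun h => ?_, fun h => by omega⟩
        obtain ⟨b, hb, rfl⟩ := hfix ha hl hk h.le
        rw [Nat.lt_succ_iff]
        refine Nat.mul_le_mul_left _ (Nat.pow_le_pow_right hp.pos ?_)
        by_contra hcon
        have : b = l + 1 := by omega
        rw [this, ← hl] at h
        omega
      rw [hset, ih _ hlt hn0, jump, if_pos ⟨_, hn'⟩]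
      have h1 := hδ (a * p ^ l)
      rw [← hn'] at h1
      rw [show n / p = a * p ^ l by rw [hn', Nat.mul_div_cancel_left _ hp.pos]]
      omega

/-- A finitely supported multiplicity function of total mass `s` is the fibre-counting function of
a monotone `s`-tuple. -/
theorem exists_monotone_card_filter {K s : ℕ} {c : ℕ → ℕ} (hc : ∑ k ∈ range K, c k = s) :
    ∃ f : Fin s → ℕ, Monotone f ∧ (∀ i, c (f i) ≠ 0) ∧
      ∀ (P : ℕ → Prop) [DecidablePred P],
        (univ.filter fun i => P (f i)).card = ∑ k ∈ range K with P k, c k := by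
  have hcard : Fintype.card (Σ k : Fin K, Fin (c k)) = Fintype.card (Fin s) := by
    simp [← hc, Finset.sum_range]
  let E := Fintype.equivOfCardEq hcard
  let g : Fin s → ℕ := fun i => (E.symm i).1
  refine ⟨g ∘ Tuple.sort g, Tuple.monotone_sort g, fun i h => ?_, fun P _ => ?_⟩
  · have := (E.symm (Tuple.sort g i)).2.pos
    have h' : c (E.symm (Tuple.sort g i)).1 = 0 := h
    omega
  · have h1 : (univ.filter fun i => P ((g ∘ Tuple.sort g) i)).card =
        (univ.filter fun x : Σ k : Fin K, Fin (c k) => P x.1).card := by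
      refine card_equiv ((Tuple.sort g).trans E.symm) fun i => ?_
      simp [g]
    rw [h1, card_filter, Fintype.sum_sigma, sum_filter, Finset.sum_range]
    refine sum_congr rfl fun k _ => ?_
    by_cases h : P k <;> simp [h]

theorem exists_monotone_count {p : ℕ} [Fact p.Prime] {δ : ℕ → ℕ} {s N : ℕ}
    (h0 : δ 0 = 0) (hδ : ∀ n, δ n ≤ δ (p * n))
    (hN : ∀ n, N ≤ n → ∑ k ∈ range n, δ k + s = ∑ k ∈ range (p * n), δ k) :
    ∃ ns : Fin s → ℕ, (∀ i, 0 < ns i) ∧ Monotone ns ∧ ∀ n, n ≠ 0 →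
      (univ.filter fun i => ns i ≤ n ∧ nstar p (ns i) = nstar p n).card = δ n := by
  have hp : p.Prime := Fact.out
  have hsum : ∀ n, N ≤ n → ∑ k ∈ range (p * n), jump p δ k = s := fun n hn => by
    have := sum_jump_range hp.pos hδ n
    have := hN n hn
    omega
  obtain ⟨ns, hmono, hne, hcount⟩ := exists_monotone_card_filter (hsum N le_rfl)
  have hvanish : ∀ k, p * N ≤ k → jump p δ k = 0 := by
    intro k hk
    have h1 := hsum (N + (k + 1)) (by omega)
    rw [mul_add, sum_range_add, hsum N le_rfl] at h1
    have h2 : ∑ x ∈ range (p * (k + 1)), jump p δ (p * N + x) = 0 := by omega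
    have h3 := sum_eq_zero_iff.1 h2 (k - p * N) (by
      rw [mem_range]
      have := Nat.le_mul_of_pos_left (k + 1) hp.pos
      omega)
    rwa [Nat.add_sub_cancel' hk] at h3
  refine ⟨ns, fun i => Nat.pos_of_ne_zero fun h => hne i ?_, hmono, fun n hn => ?_⟩
  · simp [h, jump, h0]
  · rw [hcount fun k => k ≤ n ∧ nstar p k = nstar p n, ← sum_jump_filter hδ hn,
      sum_filter, sum_filter]
    have hA : ∀ k, (if k ≤ n ∧ nstar p k = nstar p n then jump p δ k else 0) =
        if k ∈ range (n + 1) then (if nstar p k = nstar p n then jump p δ k else 0) else 0 := by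
      intro k
      simp only [mem_range, Nat.lt_succ_iff]
      split_ifs <;> tauto
    rw [sum_congr rfl fun k _ => hA k, sum_ite_mem, inter_comm, ← sum_ite_mem]
    refine sum_congr rfl fun k _ => ?_
    split_ifs with h1 h2
    · rfl
    · rfl
    · exact (hvanish k (by simpa using h1)).symm
    · rfl

end Counting

section Filtration

variable {p : ℕ} [Fact p.Prime]

/-- The kernel of the projection `M → M^{(n)}`. -/
def projKer (p : ℕ) [Fact p.Prime] (ι : Type) (r : ℕ → ℕ → ℕ) (n : ℕ) :
    AddSubgroup (NStar p × ι → ℤ_[p]) where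
  carrier := {m | ∀ x, (p : ℤ_[p]) ^ r n (x.1 : ℕ) ∣ m x}
  zero_mem' _ := dvd_zero _
  add_mem' {a b} ha hb := fun x => by simpa using dvd_add (ha x) (hb x)
  neg_mem' {a} ha := fun x => by simpa using ha x

variable {ι : Type} {r : ℕ → ℕ → ℕ}

theorem mem_projKer {n : ℕ} {m : NStar p × ι → ℤ_[p]} :
    m ∈ projKer p ι r n ↔ ∀ x, (p : ℤ_[p]) ^ r n (x.1 : ℕ) ∣ m x := Iff.rfl

/-- `Mproj` as an additive homomorphism. -/
def MprojHom (p : ℕ) [Fact p.Prime] (ι : Type) (r : ℕ → ℕ → ℕ) (n : ℕ) :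
    (NStar p × ι → ℤ_[p]) →+ ((x : NStar p × ι) → ZMod (p ^ r n (x.1 : ℕ))) where
  toFun := Mproj p ι r n
  map_zero' := by ext x; simp [Mproj]
  map_add' a b := by ext x; simp [Mproj]

theorem ker_MprojHom (n : ℕ) : (MprojHom p ι r n).ker = projKer p ι r n := by
  ext m
  rw [AddMonoidHom.mem_ker, mem_projKer]
  simp only [MprojHom, AddMonoidHom.coe_mk, ZeroHom.coe_mk, Mproj, funext_iff, Pi.zero_apply]
  refine forall_congr' fun x => ?_
  rw [← RingHom.mem_ker, PadicInt.ker_toZModPow, Ideal.mem_span_singleton]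

theorem MprojHom_surjective (n : ℕ) : Function.Surjective (MprojHom p ι r n) := by
  intro z
  choose y hy using fun x => ZMod.ringHom_surjective
    (PadicInt.toZModPow (p := p) (r n ((x : NStar p × ι).1 : ℕ))) (z x)
  exact ⟨y, funext hy⟩

/-- Multiplication by `p` as an additive endomorphism. -/
def mulPHom (p : ℕ) [Fact p.Prime] (κ : Type) : (κ → ℤ_[p]) →+ (κ → ℤ_[p]) :=
  DistribSMul.toAddMonoidHom _ (p : ℤ_[p])

@[simp] theorem mulPHom_apply {κ : Type} (a : κ → ℤ_[p]) (i : κ) :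
    mulPHom p κ a i = p * a i := rfl

theorem mem_range_mulPHom {κ : Type} {a : κ → ℤ_[p]} :
    a ∈ (mulPHom p κ).range ↔ ∀ i, (p : ℤ_[p]) ∣ a i := by
  constructor
  · rintro ⟨b, rfl⟩ i
    exact ⟨b i, rfl⟩
  · intro h
    choose b hb using h
    exact ⟨b, funext fun i => (hb i).symm⟩

theorem mulPHom_injective (κ : Type) : Function.Injective (mulPHom p κ) := by
  intro a b h
  funext i
  have hp : (p : ℤ_[p]) ≠ 0 := by exact_mod_cast (Fact.out : p.Prime).ne_zero
  exact mul_left_cancel₀ hp (congrFun h i)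

theorem index_range_mulPHom (κ : Type) [Fintype κ] :
    (mulPHom p κ).range.index = p ^ Fintype.card κ := by
  let f : (κ → ℤ_[p]) →+ (κ → ZMod p) := (PadicInt.toZMod (p := p)).toAddMonoidHom.compLeft κ
  have hf : f.ker = (mulPHom p κ).range := by
    ext a
    rw [mem_range_mulPHom, AddMonoidHom.mem_ker, funext_iff]
    refine forall_congr' fun i => ?_
    change PadicInt.toZMod (a i) = 0 ↔ _
    rw [← RingHom.mem_ker, PadicInt.ker_toZMod, PadicInt.maximalIdeal_eq_span_p,
      Ideal.mem_span_singleton]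
  have hs : Function.Surjective f := by
    intro z
    choose y hy using fun i => ZMod.ringHom_surjective (PadicInt.toZMod (p := p)) (z i)
    exact ⟨y, funext hy⟩
  rw [← hf, AddSubgroup.index_ker, AddMonoidHom.range_eq_top.2 hs, AddSubgroup.card_top,
    Nat.card_fun, Nat.card_zmod, Nat.card_eq_fintype_card]

theorem projKer_le {n k : ℕ} (h : ∀ j, 1 ≤ j → r n j ≤ r k j) :
    projKer p ι r k ≤ projKer p ι r n := fun _ hm x =>
  (pow_dvd_pow _ (h _ x.1.2.1)).trans (hm x)

theorem comap_mulPHom_projKer (hr : ∀ n j l : ℕ, 1 ≤ j → (r n j ≤ l ↔ n ≤ j * p ^ l))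
    {n k : ℕ} (hk : ∀ t, n ≤ t ↔ k ≤ p * t) :
    (projKer p ι r k).comap (mulPHom p _) = projKer p ι r n := by
  have hp : (p : ℤ_[p]) ≠ 0 := by exact_mod_cast (Fact.out : p.Prime).ne_zero
  ext m
  rw [AddSubgroup.mem_comap, mem_projKer, mem_projKer]
  refine forall_congr' fun x => ?_
  obtain ⟨⟨j, hj⟩, β⟩ := x
  rw [mulPHom_apply]
  have hstep : ∀ t, r k j ≤ t + 1 ↔ r n j ≤ t := fun t => by
    rw [hr _ _ _ hj.1, hr _ _ _ hj.1, hk, pow_succ]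
    ring_nf
  rcases h : r k j with _ | l
  · have h0 : r n j = 0 := Nat.le_zero.1 ((hstep 0).1 (by omega))
    simp [h0]
  · have h1 : r n j = l := by
      apply le_antisymm
      · exact (hstep l).1 h.le
      · have := (hstep (r n j)).2 le_rfl
        omega
    rw [h1, pow_succ', mul_dvd_mul_iff_left hp]

/-- The homomorphism placing `p ^ v` times a vector in the components indexed by `j`. -/
def single (p : ℕ) [Fact p.Prime] (ι : Type) (j : NStar p) (v : ℕ) :
    (ι → ℤ_[p]) →+ (NStar p × ι → ℤ_[p]) where
  toFun f x := if x.1 = j then (p : ℤ_[p]) ^ v * f x.2 else 0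
  map_zero' := by ext x; simp
  map_add' a b := by
    ext x
    by_cases h : x.1 = j <;> simp [h, mul_add]

theorem single_apply {j : NStar p} {v : ℕ} (f : ι → ℤ_[p]) (x : NStar p × ι) :
    single p ι j v f x = if x.1 = j then (p : ℤ_[p]) ^ v * f x.2 else 0 := rfl

theorem relIndex_projKer_succ [Fintype ι]
    (hr : ∀ n j l : ℕ, 1 ≤ j → (r n j ≤ l ↔ n ≤ j * p ^ l)) {n : ℕ} (hn : 1 ≤ n) :
    (projKer p ι r (n + 1)).relIndex (projKer p ι r n) = p ^ Fintype.card ι := by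
  have hp : p.Prime := Fact.out
  have hp0 : (p : ℤ_[p]) ≠ 0 := by exact_mod_cast hp.ne_zero
  obtain ⟨v, j, hj, rfl⟩ := Nat.exists_eq_pow_mul_and_not_dvd (by omega : n ≠ 0) p hp.ne_one
  have hj0 : 0 < j := Nat.pos_of_ne_zero fun h => hj (h ▸ dvd_zero p)
  set n := p ^ v * j with hndef
  let J : NStar p := ⟨j, hj0, hj⟩
  have hpow : ∀ {a b : ℕ}, p ^ a ≤ p ^ b ↔ a ≤ b := Nat.pow_le_pow_iff_right hp.one_lt
  have hrn : r n j = v := by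
    have : ∀ l, r n j ≤ l ↔ v ≤ l := fun l => by
      rw [hr _ _ _ hj0, hndef, mul_comm, Nat.mul_le_mul_left_iff hj0, hpow]
    exact le_antisymm ((this v).2 le_rfl) ((this _).1 le_rfl)
  have hrn1 : r (n + 1) j = v + 1 := by
    have : ∀ l, r (n + 1) j ≤ l ↔ v + 1 ≤ l := fun l => by
      rw [hr _ _ _ hj0, hndef, mul_comm, Nat.succ_le_iff, Nat.mul_lt_mul_left hj0,
        Nat.pow_lt_pow_iff_right hp.one_lt, Nat.succ_le_iff]
    exact le_antisymm ((this _).2 le_rfl) ((this _).1 le_rfl)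
  have hother : ∀ i : NStar p, i ≠ J → r (n + 1) i = r n i := by
    intro i hi
    have : ∀ l, r (n + 1) i ≤ l ↔ r n i ≤ l := fun l => by
      rw [hr _ _ _ i.2.1, hr _ _ _ i.2.1]
      refine ⟨fun h => by omega, fun h => lt_of_le_of_ne h fun h' => hi ?_⟩
      have h1 := nstar_mul_pow i.2.2 l
      rw [← h', hndef, mul_comm, nstar_mul_pow hj v] at h1
      exact Subtype.ext h1.symm
    exact le_antisymm ((this _).2 le_rfl) ((this _).1 le_rfl)
  have hle : projKer p ι r (n + 1) ≤ projKer p ι r n := projKer_le fun i hi => by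
    rw [hr _ _ _ hi]
    have := (hr (n + 1) i _ hi).1 le_rfl
    omega
  have hsup : projKer p ι r n = (single p ι J v).range ⊔ projKer p ι r (n + 1) := by
    apply le_antisymm
    · intro m hm
      have hd : ∀ b, (p : ℤ_[p]) ^ v ∣ m (J, b) := fun b => by
        simpa [J, hrn] using hm (J, b)
      choose f hf using hd
      refine AddSubgroup.mem_sup.2 ⟨_, ⟨f, rfl⟩, m - single p ι J v f, fun x => ?_, by simp⟩
      obtain ⟨i, b⟩ := x
      by_cases hi : i = J
      · subst hi
        simp [single_apply, ← hf]
      · simpa [single_apply, hi, hother i hi] using hm (i, b)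
    · refine sup_le ?_ hle
      rintro _ ⟨f, rfl⟩ ⟨i, b⟩
      by_cases hi : i = J
      · subst hi
        simp [single_apply, J, hrn]
      · simp [single_apply, hi]
  rw [hsup, AddSubgroup.relIndex_sup_right, ← AddSubgroup.index_comap, ← index_range_mulPHom]
  congr 1
  ext f
  rw [AddSubgroup.mem_comap, mem_range_mulPHom, mem_projKer]
  constructor
  · intro h b
    have := h (J, b)
    simp only [single_apply, if_true] at this
    change _ ^ r (n + 1) j ∣ _ at this
    rwa [hrn1, pow_succ, mul_dvd_mul_iff_left (pow_ne_zero _ hp0)] at this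
  · rintro h ⟨i, b⟩
    by_cases hi : i = J
    · subst hi
      simp only [single_apply, if_true]
      change _ ^ r (n + 1) j ∣ _
      rw [hrn1, pow_succ, mul_dvd_mul_iff_left (pow_ne_zero _ hp0)]
      exact h b
    · simp [single_apply, hi]

theorem index_projKer [Fintype ι]
    (hr : ∀ n j l : ℕ, 1 ≤ j → (r n j ≤ l ↔ n ≤ j * p ^ l)) (n : ℕ) :
    (projKer p ι r (n + 1)).index = p ^ (n * Fintype.card ι) := by
  induction n with
  | zero =>
    have : projKer p ι r 1 = ⊤ := by
      refine eq_top_iff.2 fun m _ x => ?_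
      have h0 : r 1 (x.1 : ℕ) = 0 :=
        Nat.le_zero.1 ((hr _ _ _ x.1.2.1).2 (by simpa using Nat.succ_le_iff.2 x.1.2.1))
      simp [h0]
    simp [this]
  | succ n ih =>
    have hle : projKer p ι r (n + 1 + 1) ≤ projKer p ι r (n + 1) := projKer_le fun i hi => by
      rw [hr _ _ _ hi]
      have := (hr (n + 1 + 1) i _ hi).1 le_rfl
      omega
    rw [← AddSubgroup.relIndex_mul_index hle, ih, relIndex_projKer_succ hr (by omega),
      ← pow_add]
    ring_nf

end Filtration

section Lattice

variable {p : ℕ} [Fact p.Prime] {ι : Type} {r : ℕ → ℕ → ℕ} {s : ℕ}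

/-- The homomorphism `ℤ_p^s → M` sending the standard basis to `m`. -/
def combHom (m : Fin s → (NStar p × ι → ℤ_[p])) :
    (Fin s → ℤ_[p]) →+ (NStar p × ι → ℤ_[p]) :=
  (Fintype.linearCombination ℤ_[p] m).toAddMonoidHom

theorem combHom_apply (m : Fin s → (NStar p × ι → ℤ_[p])) (a : Fin s → ℤ_[p])
    (x : NStar p × ι) : combHom m a x = ∑ i, a i * m i x := by
  change Fintype.linearCombination ℤ_[p] m a x = _
  simp [Fintype.linearCombination_apply]

/-- The filtration of `ℤ_p^s` pulled back from `M` along `combHom m`. -/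
def latticeFilt (r : ℕ → ℕ → ℕ) (m : Fin s → (NStar p × ι → ℤ_[p])) (n : ℕ) :
    AddSubgroup (Fin s → ℤ_[p]) :=
  (projKer p ι r n).comap (combHom m)

theorem mem_latticeFilt {m : Fin s → (NStar p × ι → ℤ_[p])} {n : ℕ} {a : Fin s → ℤ_[p]} :
    a ∈ latticeFilt r m n ↔ ∀ x, (p : ℤ_[p]) ^ r n (x.1 : ℕ) ∣ combHom m a x := Iff.rfl

theorem antitone_latticeFilt (hr : ∀ n j l : ℕ, 1 ≤ j → (r n j ≤ l ↔ n ≤ j * p ^ l))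
    (m : Fin s → (NStar p × ι → ℤ_[p])) : Antitone (latticeFilt r m) := by
  intro n k hnk
  refine AddSubgroup.comap_mono (projKer_le fun j hj => ?_)
  rw [hr _ _ _ hj]
  exact hnk.trans ((hr k j _ hj).1 le_rfl)

theorem comap_mulPHom_latticeFilt (hr : ∀ n j l : ℕ, 1 ≤ j → (r n j ≤ l ↔ n ≤ j * p ^ l))
    (m : Fin s → (NStar p × ι → ℤ_[p])) {n k : ℕ} (hk : ∀ t, n ≤ t ↔ k ≤ p * t) :
    (latticeFilt r m k).comap (mulPHom p _) = latticeFilt r m n := by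
  rw [latticeFilt, latticeFilt, ← comap_mulPHom_projKer hr hk, AddSubgroup.comap_comap,
    AddSubgroup.comap_comap]
  congr 1
  ext a x
  simp [combHom_apply, Finset.mul_sum, mul_assoc]

theorem index_latticeFilt_dvd (m : Fin s → (NStar p × ι → ℤ_[p])) (n : ℕ) :
    (latticeFilt r m n).index ∣ (projKer p ι r n).index := by
  rw [latticeFilt, AddSubgroup.index_comap]
  exact AddSubgroup.relIndex_dvd_index_of_normal _ _

theorem index_closure_mul_index_latticeFilt
    (hr : ∀ n j l : ℕ, 1 ≤ j → (r n j ≤ l ↔ n ≤ j * p ^ l))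
    (m : Fin s → (NStar p × ι → ℤ_[p])) (n : ℕ) :
    (AddSubgroup.closure (Set.range fun i => Mproj p ι r n (m i))).index *
      (latticeFilt r m n).index = (projKer p ι r n).index := by
  have h1 : AddSubgroup.closure (Set.range fun i => Mproj p ι r n (m i)) =
      (AddSubgroup.closure (Set.range m)).map (MprojHom p ι r n) := by
    rw [AddMonoidHom.map_closure, ← Set.range_comp]
    rfl
  have h2 : AddSubgroup.closure (Set.range m) ⊔ projKer p ι r n =
      (combHom m).range ⊔ projKer p ι r n := by
    apply le_antisymm
    · refine sup_le_sup_right ?_ _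
      rw [AddSubgroup.closure_le]
      rintro _ ⟨i, rfl⟩
      refine ⟨Pi.single i 1, ?_⟩
      ext x
      simp [combHom_apply, Pi.single_apply]
    · refine sup_le ?_ le_sup_right
      rintro _ ⟨a, rfl⟩
      refine AddSubgroup.mem_sup.2 ⟨∑ i, (a i).appr n • m i, ?_,
        combHom m a - ∑ i, (a i).appr n • m i, fun x => ?_, by simp⟩
      · exact sum_mem fun i _ => AddSubgroup.nsmul_mem _
          (AddSubgroup.subset_closure (Set.mem_range_self i)) _
      · have hx : r n (x.1 : ℕ) ≤ n := by
          rw [hr _ _ _ x.1.2.1]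
          have := Nat.lt_pow_self (Fact.out : p.Prime).one_lt (n := n)
          exact this.le.trans (Nat.le_mul_of_pos_left _ x.1.2.1)
        refine (pow_dvd_pow _ hx).trans ?_
        rw [Pi.sub_apply, combHom_apply, Finset.sum_apply, ← Finset.sum_sub_distrib]
        refine Finset.dvd_sum fun i _ => ?_
        rw [Pi.smul_apply, nsmul_eq_mul, ← sub_mul]
        exact Dvd.dvd.mul_right (Ideal.mem_span_singleton.1 (PadicInt.appr_spec n (a i))) _
  rw [h1, ← AddSubgroup.index_comap_of_surjective _ (MprojHom_surjective n),
    AddSubgroup.comap_map_eq, ker_MprojHom, h2, latticeFilt, AddSubgroup.index_comap,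
    ← AddSubgroup.relIndex_sup_right, mul_comm]
  exact AddSubgroup.relIndex_mul_index le_sup_right

theorem exists_latticeFilt_le_range (hr : ∀ n j l : ℕ, 1 ≤ j → (r n j ≤ l ↔ n ≤ j * p ^ l))
    {m : Fin s → (NStar p × ι → ℤ_[p])} (hm : LinearIndependent ℤ_[p] m) :
    ∃ N, ∀ n, N ≤ n → latticeFilt r m n ≤ (mulPHom p (Fin s)).range := by
  have hp : p.Prime := Fact.out
  suffices h : ∃ N, latticeFilt r m N ≤ (mulPHom p (Fin s)).range by
    obtain ⟨N, hN⟩ := h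
    exact ⟨N, fun n hn => (antitone_latticeFilt hr m hn).trans hN⟩
  by_contra! hcon
  let C : Set (Fin s → ℤ_[p]) := ((mulPHom p (Fin s)).range : Set (Fin s → ℤ_[p]))ᶜ
  have hC : IsClosed C := by
    rw [isClosed_compl_iff]
    have : ((mulPHom p (Fin s)).range : Set (Fin s → ℤ_[p])) =
        ⋂ i, {a : Fin s → ℤ_[p] | ‖a i‖ < 1} := by
      ext a
      rw [SetLike.mem_coe, mem_range_mulPHom]
      simp [PadicInt.norm_lt_one_iff_dvd]
    rw [this]
    exact isOpen_iInter_of_finite fun i => isOpen_lt (by fun_prop) continuous_const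
  have hcl : ∀ n, IsClosed (latticeFilt r m n : Set (Fin s → ℤ_[p])) := by
    intro n
    have : (latticeFilt r m n : Set (Fin s → ℤ_[p])) =
        ⋂ x : NStar p × ι, {a | ‖∑ i, a i * m i x‖ ≤ (p : ℝ) ^ (-(r n (x.1 : ℕ)) : ℤ)} := by
      ext a
      rw [SetLike.mem_coe, mem_latticeFilt]
      simp only [Set.mem_iInter, Set.mem_ofPred_eq, PadicInt.norm_le_pow_iff_mem_span_pow,
        Ideal.mem_span_singleton, combHom_apply]
    rw [this]
    exact isClosed_iInter fun x => isClosed_le (by fun_prop) continuous_const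
  obtain ⟨a, ha⟩ := IsCompact.nonempty_iInter_of_sequence_nonempty_isCompact_isClosed
    (fun n => (latticeFilt r m n : Set (Fin s → ℤ_[p])) ∩ C)
    (fun n => Set.inter_subset_inter_left _ (antitone_latticeFilt hr m n.le_succ))
    (fun n => by
      obtain ⟨a, ha, ha'⟩ := SetLike.not_le_iff_exists.1 (hcon n)
      exact ⟨a, ha, ha'⟩)
    ((hcl 0).inter hC).isCompact (fun n => (hcl n).inter hC)
  rw [Set.mem_iInter] at ha
  have hzero : combHom m a = 0 := by
    ext1 x
    by_contra hne
    have hall : ∀ l, (p : ℤ_[p]) ^ l ∣ combHom m a x := by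
      intro l
      refine (pow_dvd_pow _ ?_).trans (mem_latticeFilt.1 (ha (x.1 * p ^ l + 1)).1 x)
      by_contra hlt
      have := (hr _ _ _ x.1.2.1).1 (Nat.le_of_lt (not_le.1 hlt))
      omega
    have := (PadicInt.norm_le_pow_iff_le_valuation _ hne ((combHom m a x).valuation + 1)).1
      ((PadicInt.norm_le_pow_iff_mem_span_pow _ _).2 (Ideal.mem_span_singleton.2 (hall _)))
    omega
  have ha0 : a = 0 := hm.fintypeLinearCombination_injective (hzero.trans (map_zero _).symm)
  exact (ha 0).2 (ha0 ▸ zero_mem _)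

theorem exists_index_latticeFilt [Fintype ι]
    (hr : ∀ n j l : ℕ, 1 ≤ j → (r n j ≤ l ↔ n ≤ j * p ^ l))
    {m : Fin s → (NStar p × ι → ℤ_[p])} (hm : LinearIndependent ℤ_[p] m) :
    ∃ d : ℕ → ℕ, (∀ n, (latticeFilt r m n).index = p ^ d n) ∧ d 0 = 0 ∧ d 1 = 0 ∧ Monotone d ∧
      (∀ n, d (n + 1) + d (p * n) ≤ d (p * n + 1) + d n) ∧
      ∃ N, ∀ n, N ≤ n → d (p * n) = d n + s := by
  have hp : p.Prime := Fact.out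
  have hex : ∀ n, ∃ d, (latticeFilt r m n).index = p ^ d := by
    intro n
    have h1 : (latticeFilt r m (n + 1)).index ∣ p ^ (n * Fintype.card ι) := by
      rw [← index_projKer hr n]
      exact index_latticeFilt_dvd m _
    obtain ⟨d, -, hd⟩ := (Nat.dvd_prime_pow hp).1
      ((AddSubgroup.index_dvd_of_le (antitone_latticeFilt hr m n.le_succ)).trans h1)
    exact ⟨d, hd⟩
  choose d hd using hex
  have hmono : Monotone d := by
    intro n k hnk
    rw [← Nat.pow_dvd_pow_iff_le_right hp.one_lt, ← hd, ← hd]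
    exact AddSubgroup.index_dvd_of_le (antitone_latticeFilt hr m hnk)
  have hd1 : d 1 = 0 := by
    have h1 := hd 1
    have : (latticeFilt r m 1).index ∣ 1 := by
      simpa [index_projKer hr 0] using index_latticeFilt_dvd (r := r) m 1
    rw [Nat.dvd_one.1 this] at h1
    exact (Nat.pow_eq_one.1 h1.symm).resolve_left hp.ne_one
  have hrel : ∀ {n k}, n ≤ k →
      (latticeFilt r m k).relIndex (latticeFilt r m n) = p ^ (d k - d n) := by
    intro n k hnk
    have h1 := AddSubgroup.relIndex_mul_index (antitone_latticeFilt hr m hnk)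
    rw [hd, hd] at h1
    refine Nat.eq_of_mul_eq_mul_right (pow_pos hp.pos (d n)) ?_
    rw [h1, ← pow_add, Nat.sub_add_cancel (hmono hnk)]
  have hmul : ∀ n, (latticeFilt r m (p * n)).comap (mulPHom p _) = latticeFilt r m n :=
    fun n => comap_mulPHom_latticeFilt hr m fun t => (Nat.mul_le_mul_left_iff hp.pos).symm
  refine ⟨d, hd, Nat.le_zero.1 ((hmono zero_le_one).trans hd1.le), hd1, hmono, fun n => ?_, ?_⟩
  · have h1 : (latticeFilt r m (p * n + 1)).comap (mulPHom p _) = latticeFilt r m (n + 1) :=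
      comap_mulPHom_latticeFilt hr m fun t => by
        rw [Nat.succ_le_iff, Nat.succ_le_iff, Nat.mul_lt_mul_left hp.pos]
    have h2 : (latticeFilt r m n).map (mulPHom p _) ≤ latticeFilt r m (p * n) := by
      rw [AddSubgroup.map_le_iff_le_comap, hmul]
    have h3 := AddSubgroup.relIndex_le_of_le_right h2
      (H := latticeFilt r m (p * n + 1)) (by
        rw [hrel (Nat.le_succ _)]
        exact (pow_pos hp.pos _).ne')
    rw [← AddSubgroup.relIndex_comap, h1, hrel (Nat.le_succ _), hrel (Nat.le_succ _),
      Nat.pow_le_pow_iff_right hp.one_lt] at h3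
    have := hmono n.le_succ
    have := hmono (p * n).le_succ
    simp only [Nat.succ_eq_add_one] at *
    omega
  · obtain ⟨N, hN⟩ := exists_latticeFilt_le_range hr hm
    refine ⟨N, fun n hn => ?_⟩
    have h1 : (latticeFilt r m n).map (mulPHom p _) = latticeFilt r m (p * n) := by
      rw [← hmul n, AddSubgroup.map_comap_eq, inf_eq_right]
      exact hN _ (hn.trans (Nat.le_mul_of_pos_left _ hp.pos))
    have h2 := AddSubgroup.index_map_of_injective (latticeFilt r m n)
      (mulPHom_injective (p := p) (Fin s))
    rw [h1, hd, hd, index_range_mulPHom, Fintype.card_fin, ← pow_add] at h2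
    exact Nat.pow_right_injective hp.two_le h2

end Lattice

/-- Let `m_1, …, m_s ∈ M` be `ℤ_p`-linearly independent.  Then there are positive
integers `n_1 ≤ … ≤ n_s` such that, with
`δ^{(n)} = #{ i : n_i ≤ n ∧ n_i* = n* }` and `λ^{(n)} = log_p` of the index of
`ℤ·m_1^{(n)} + … + ℤ·m_s^{(n)}` in `M^{(n)}`, one has
`λ^{(n+1)} = λ^{(n)} + e − δ^{(n)}` for every `n ≥ 1`. -/
theorem stmt_19 (p : ℕ) [Fact p.Prime] (e : ℕ) (he : 1 ≤ e)
    (ι : Type) [Fintype ι] (hι : Fintype.card ι = e)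
    (r : ℕ → ℕ → ℕ)
    (hr : ∀ n j : ℕ, 1 ≤ j → IsLeast {l : ℕ | n ≤ j * p ^ l} (r n j))
    (s : ℕ) (m : Fin s → (NStar p × ι → ℤ_[p]))
    (hm : LinearIndependent ℤ_[p] m) :
    ∃ ns : Fin s → ℕ, (∀ i, 0 < ns i) ∧ Monotone ns ∧
      ∀ lam : ℕ → ℕ,
        (∀ k : ℕ, 1 ≤ k → p ^ lam k =
          (AddSubgroup.closure (Set.range fun i => Mproj p ι r k (m i))).index) →
        ∀ n : ℕ, 1 ≤ n →
          (lam (n + 1) : ℤ) = lam n + e -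
            (Finset.univ.filter (fun i : Fin s =>
              ns i ≤ n ∧ nstar p (ns i) = nstar p n)).card := by
  have hp : p.Prime := Fact.out
  have hr' : ∀ n j l : ℕ, 1 ≤ j → (r n j ≤ l ↔ n ≤ j * p ^ l) := fun n j l hj =>
    ⟨fun h => (hr n j hj).1.trans (Nat.mul_le_mul_left _ (Nat.pow_le_pow_right hp.pos h)),
      fun h => (hr n j hj).2 h⟩
  obtain ⟨d, hd, hd0, hd1, hmono, hstep, N, hN⟩ := exists_index_latticeFilt hr' hm
  have hsum : ∀ n, ∑ k ∈ Finset.range n, (d (k + 1) - d k) = d n := fun n => by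
    rw [Finset.sum_range_tsub hmono, hd0, Nat.sub_zero]
  obtain ⟨ns, hpos, hns, hcount⟩ := exists_monotone_count (p := p) (s := s) (N := N)
    (δ := fun n => d (n + 1) - d n) (by simp [hd0, hd1])
    (fun n => by
      have := hstep n
      have := hmono n.le_succ
      have := hmono (p * n).le_succ
      simp only [Nat.succ_eq_add_one] at *
      omega)
    (fun n hn => by rw [hsum, hsum, hN n hn])
  refine ⟨ns, hpos, hns, fun lam hlam n hn => ?_⟩
  have hlam' : ∀ k, lam (k + 1) + d (k + 1) = k * e := fun k => by
    have h := index_closure_mul_index_latticeFilt hr' m (k + 1)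
    rw [← hlam _ (by omega), hd, index_projKer hr', hι, ← pow_add] at h
    exact Nat.pow_right_injective hp.two_le h
  rw [hcount n (by omega)]
  obtain ⟨k, rfl⟩ : ∃ k, n = k + 1 := ⟨n - 1, by omega⟩
  have h1 := hlam' k
  have h2 := hlam' (k + 1)
  have := hmono (k + 1).le_succ
  rw [add_mul, one_mul] at h2
  simp only [Nat.succ_eq_add_one] at *
  omega

end
end
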